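/- Let B = {0,1}^ℤ be the set of bi-infinite binary sequences, and make B a rack via the constant action rack structure a ▷ b = ℓ(a), a ◁ b = r(a), where ℓ and r are the left- and right-shift operators given by (ℓ(a))_i = a_{i+1} and (r(a))_i = a_{i−1}. Define the relation ∼ on B by a ∼ b iff a_i = b_i for all i ≥ 0. Then ∼ is an equivalence relation which is a ▷-congruence but not a ◁-congruence; that is, ∼ is a half congruence on this rack. -/

import Mathlib

/-- On the constant action rack of bi-infinite binary sequences `ℤ → Bool`
with `a ▷ b = ℓ(a)` (left shift, `(ℓ a) i = a (i+1)`) and `a ◁ b = r(a)`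
(right shift, `(r a) i = a (i-1)`), the relation `a ∼ b ↔ ∀ i ≥ 0, a i = b i`
is an equivalence relation that is a `▷`-congruence but not a `◁`-congruence:
a half congruence. -/
theorem stmt_12 :
    Equivalence (fun a b : ℤ → Bool => ∀ i : ℤ, 0 ≤ i → a i = b i) ∧
    (∀ a b c d : ℤ → Bool, (∀ i : ℤ, 0 ≤ i → a i = c i) →
      (∀ i : ℤ, 0 ≤ i → b i = d i) →
      ∀ i : ℤ, 0 ≤ i → a (i + 1) = c (i + 1)) ∧
    ¬ (∀ a b c d : ℤ → Bool, (∀ i : ℤ, 0 ≤ i → a i = c i) →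
      (∀ i : ℤ, 0 ≤ i → b i = d i) →
      ∀ i : ℤ, 0 ≤ i → a (i - 1) = c (i - 1)) := by
  refine ⟨⟨fun a i _ => rfl, fun h i hi => (h i hi).symm,
    fun h k i hi => (h i hi).trans (k i hi)⟩,
    fun a b c d h _ i hi => h (i + 1) (by omega), fun H => ?_⟩
  have h := H (fun _ => true) (fun _ => true) (fun i => decide (0 ≤ i)) (fun _ => true)
    (fun i hi => (decide_eq_true hi).symm) (fun _ _ => rfl) 0 le_rfl
  simp at h
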